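/- Suppose μ−η and λ−η lie in the lowest p-alcove C₀, s, w ∈ W, and there exist u ∈ W and ν ∈ X such that w = u s π(u)⁻¹ and λ = u(μ) + pν − w(π(ν)). Then ⟨ν,α∨⟩ ≤ 2 for every root α, and if ⟨ν,α∨⟩ = 2 for some root α, then: α∨ is a highest coroot; ⟨μ,α∨⟩ = p−1 = ⟨λ,α∨⟩; u commutes with the reflection s_α; and ⟨w(π(ν)),α∨⟩ = 2. Conversely, if these four conditions hold for α then ⟨ν,α∨⟩ = 2. -/

import Mathlib

open scoped Classical Pointwise

namespace SerrePaper

variable (V : Type) [AddCommGroup V] [Module ℝ V]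

/-- The combinatorial context of the paper: the character lattice `X` of a split maximal
torus, sitting inside the real vector space `V = X ⊗ ℝ`, together with a reduced
crystallographic root system `R` with positive roots `Rpos`, simple roots `Δ`,
the coroot pairing `coroot α = ⟨·, α∨⟩`, the weight `η` pairing to `1` with every simple
coroot, and the longest element `w0` of the Weyl group. -/
structure Ctx where
  R : Finset V
  Rpos : Finset V
  Δ : Finset V
  coroot : V → V →ₗ[ℝ] ℝ
  eta : V
  w0 : V ≃ₗ[ℝ] V
  X : AddSubgroup V
  pos_subset : Rpos ⊆ R
  simple_subset : Δ ⊆ Rpos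
  root_ne_zero : ∀ α ∈ R, α ≠ (0 : V)
  neg_mem : ∀ α ∈ R, -α ∈ R
  pos_or_neg : ∀ α ∈ R, α ∈ Rpos ∨ -α ∈ Rpos
  pos_not_neg : ∀ α ∈ Rpos, -α ∉ Rpos
  coroot_self : ∀ α ∈ R, coroot α α = 2
  coroot_neg : ∀ α ∈ R, coroot (-α) = -coroot α
  crystallographic : ∀ α ∈ R, ∀ β ∈ R, ∃ n : ℤ, coroot α β = (n : ℝ)
  reduced : ∀ α ∈ R, ∀ c : ℝ, c • α ∈ R → c = 1 ∨ c = -1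
  reflect_root : ∀ α ∈ R, ∀ β ∈ R, β - coroot α β • α ∈ R
  reflect_coroot : ∀ α ∈ R, ∀ β ∈ R, ∀ x : V,
    coroot (β - coroot α β • α) x = coroot β x - coroot β α * coroot α x
  pos_sum_simple : ∀ α ∈ Rpos, ∃ c : V → ℕ, α = ∑ β ∈ Δ, (c β : ℝ) • β
  simple_indep : LinearIndependent ℝ (fun β : {x // x ∈ Δ} => (β : V))
  eta_pair : ∀ α ∈ Δ, coroot α eta = 1
  root_mem_X : ∀ α ∈ R, α ∈ X
  eta_mem_X : eta ∈ X
  coroot_int : ∀ α ∈ R, ∀ x ∈ X, ∃ n : ℤ, coroot α x = (n : ℝ)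
  w0_mem : w0 ∈ Subgroup.closure {g : V ≃ₗ[ℝ] V | ∃ α ∈ R, ∀ x, g x = x - coroot α x • α}
  w0_neg : ∀ α ∈ Rpos, -(w0 α) ∈ Rpos

namespace Ctx

variable {V}
variable (S : Ctx V)

/-- The (finite) Weyl group, generated by the reflections `s_α`, `α ∈ R`. -/
def Weyl : Subgroup (V ≃ₗ[ℝ] V) :=
  Subgroup.closure {g : V ≃ₗ[ℝ] V | ∃ α ∈ S.R, ∀ x, g x = x - S.coroot α x • α}

/-- The translation `t_ν` as an affine automorphism of `V`. -/
def trans (_S : Ctx V) (ν : V) : V ≃ᵃ[ℝ] V := AffineEquiv.constVAdd ℝ V ν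

/-- A linear automorphism viewed as an affine automorphism. -/
def ofW (_S : Ctx V) (w : V ≃ₗ[ℝ] V) : V ≃ᵃ[ℝ] V := w.toAffineEquiv

/-- The extended affine Weyl group `W̃ = X ⋊ W`, realized as the set of affine
transformations of the form `t_ν ∘ w` with `ν ∈ X` and `w ∈ W`. -/
def extAff : Set (V ≃ᵃ[ℝ] V) :=
  {g | ∃ ν ∈ S.X, ∃ w ∈ S.Weyl, g = S.trans ν * S.ofW w}

/-- The base alcove `A₀`. -/
def A0 : Set V := {x | ∀ α ∈ S.Rpos, 0 < S.coroot α x ∧ S.coroot α x < 1}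

/-- The affine hyperplane `⟨·,α∨⟩ = n` separates the base alcove `A₀` from its image
`g(A₀)`. -/
def Separates (α : V) (n : ℤ) (g : V ≃ᵃ[ℝ] V) : Prop :=
  ((∀ x ∈ S.A0, S.coroot α x < (n : ℝ)) ∧ (∀ x ∈ S.A0, (n : ℝ) < S.coroot α (g x))) ∨
  ((∀ x ∈ S.A0, (n : ℝ) < S.coroot α x) ∧ (∀ x ∈ S.A0, S.coroot α (g x) < (n : ℝ)))

/-- The length `ℓ(g)` of an element of the extended affine Weyl group: the number of
affine root hyperplanes separating `A₀` from `g(A₀)`. -/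
noncomputable def len (g : V ≃ᵃ[ℝ] V) : ℕ :=
  Set.ncard {q : V × ℤ | q.1 ∈ S.Rpos ∧ S.Separates q.1 q.2 g}

/-- The set of affine reflections `s_{α,n} : x ↦ x - (⟨x,α∨⟩ - n)α`. -/
def affRefl : Set (V ≃ᵃ[ℝ] V) :=
  {g | ∃ α ∈ S.R, ∃ n : ℤ, ∀ x, g x = x - (S.coroot α x - (n : ℝ)) • α}

/-- The Bruhat order on the extended affine Weyl group, generated by
`u < r·u` for affine reflections `r` with `ℓ(u) < ℓ(r·u)` (this fixes the
`Ω`-component, so it is the componentwise extension of the Bruhat order on `W_a`). -/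
def bruhatLE : (V ≃ᵃ[ℝ] V) → (V ≃ᵃ[ℝ] V) → Prop :=
  Relation.ReflTransGen fun u w => (∃ r ∈ S.affRefl, w = r * u) ∧ S.len u < S.len w

/-- Jantzen's `↑`-order, transported to the (extended) affine Weyl group via
`w̃ ↦ w̃(A₀)`: generated by `u ↑ s_{α,n}·u` whenever `u(A₀)` lies below the hyperplane
`⟨·,α∨⟩ = n`.  (Under the affine rescaling `λ ↦ (λ+η)/p` this is equivalent to the usual
`↑`-order on `p`-alcoves, transported via the `p`-dot action `w̃ ↦ w̃ · C₀`.) -/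
def upLE : (V ≃ᵃ[ℝ] V) → (V ≃ᵃ[ℝ] V) → Prop :=
  Relation.ReflTransGen fun u w =>
    ∃ α ∈ S.Rpos, ∃ n : ℤ,
      (∀ x : V, w x = u x - (S.coroot α (u x) - (n : ℝ)) • α) ∧
      ∀ x ∈ S.A0, S.coroot α (u x) < (n : ℝ)

/-- `W̃⁺`: the elements of `W̃` taking the base alcove to a dominant alcove. -/
def Wplus : Set (V ≃ᵃ[ℝ] V) :=
  {g | g ∈ S.extAff ∧ ∀ x ∈ S.A0, ∀ α ∈ S.Δ, 0 < S.coroot α (g x)}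

/-- `W̃₁`: the elements of `W̃` taking the base alcove to a restricted alcove. -/
def Wone : Set (V ≃ᵃ[ℝ] V) :=
  {g | g ∈ S.extAff ∧ ∀ x ∈ S.A0, ∀ α ∈ S.Δ,
    0 < S.coroot α (g x) ∧ S.coroot α (g x) < 1}

/-- `w̃_h = w₀ t_{-η}`. -/
noncomputable def wh : V ≃ᵃ[ℝ] V := S.ofW S.w0 * S.trans (-S.eta)

/-- The lowest `p`-alcove `C₀`. -/
def C0 (p : ℕ) : Set V :=
  {x | ∀ α ∈ S.Rpos, 0 < S.coroot α (x + S.eta) ∧ S.coroot α (x + S.eta) < (p : ℝ)}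

/-- The root lattice `ℤR`. -/
def rootLattice : AddSubgroup V := AddSubgroup.closure (S.R : Set V)

/-- `Ω`: the stabilizer of the base alcove in `W̃`. -/
def Omega : Set (V ≃ᵃ[ℝ] V) := {g | g ∈ S.extAff ∧ g '' S.A0 = S.A0}

/-- The `λ`-admissible set `Adm(λ) = ⋃_{w ∈ W} W̃_{≤ t_{w(λ)}}`. -/
def Adm (lam : V) : Set (V ≃ᵃ[ℝ] V) :=
  {g | ∃ w ∈ S.Weyl, S.bruhatLE g (S.trans (w lam))}

/-- `α∨` is a highest coroot, i.e. the highest root of an irreducible component of the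
dual root system `R∨`: equivalently, `α∨` is a dominant coroot and no simple coroot can
be added to `α∨` to yield a coroot. -/
def IsHighestCoroot (α : V) : Prop :=
  α ∈ S.R ∧ (∀ β ∈ S.Δ, 0 ≤ S.coroot α β) ∧
    ∀ β ∈ S.Δ, ∀ γ ∈ S.R, S.coroot γ ≠ S.coroot α + S.coroot β

end Ctx

namespace Ctx

variable {V} (S : Ctx V)

lemma Weyl_root_and_coroot {v : V ≃ₗ[ℝ] V} (hv : v ∈ S.Weyl) :
    ∀ α ∈ S.R, v α ∈ S.R ∧ ∀ x, S.coroot (v α) (v x) = S.coroot α x := by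
  have key : ∀ g : V ≃ₗ[ℝ] V, (∃ α ∈ S.R, ∀ x, g x = x - S.coroot α x • α) →
      ∀ β ∈ S.R, g β ∈ S.R ∧ ∀ x, S.coroot (g β) (g x) = S.coroot β x := by
    rintro g ⟨α, hα, hg⟩ β hβ
    refine ⟨hg β ▸ S.reflect_root α hα β hβ, fun x => ?_⟩
    rw [hg β, S.reflect_coroot α hα β hβ, hg x]
    simp only [map_sub, map_smul, smul_eq_mul, S.coroot_self α hα]
    ring
  induction hv using Subgroup.closure_induction'' with
  | mem g hg => exact key g hg
  | inv_mem g hg =>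
    obtain ⟨α, hα, hg⟩ := hg
    refine key _ ⟨α, hα, fun x => ?_⟩
    change g.symm x = _
    rw [LinearEquiv.symm_apply_eq, hg]
    simp only [map_sub, map_smul, smul_eq_mul, S.coroot_self α hα]
    module
  | one => exact fun α hα => ⟨hα, fun x => rfl⟩
  | mul a b _ _ ha hb =>
    intro α hα
    obtain ⟨h1, h2⟩ := hb α hα
    obtain ⟨h3, h4⟩ := ha _ h1
    exact ⟨h3, fun x => (h4 (b x)).trans (h2 x)⟩

lemma exists_coroot_comp_Weyl {v : V ≃ₗ[ℝ] V} (hv : v ∈ S.Weyl) {α : V} (hα : α ∈ S.R) :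
    v⁻¹ α ∈ S.R ∧ ∀ x, S.coroot α (v x) = S.coroot (v⁻¹ α) x := by
  obtain ⟨h1, -⟩ := S.Weyl_root_and_coroot (inv_mem hv) α hα
  refine ⟨h1, fun x => ?_⟩
  rw [← (S.Weyl_root_and_coroot hv _ h1).2 x]
  change _ = S.coroot (v (v.symm α)) _
  rw [LinearEquiv.apply_symm_apply]

/-- The canonical Weyl-invariant form `∑_γ ⟨x,γ∨⟩⟨y,γ∨⟩`. -/
def form (x y : V) : ℝ := ∑ γ ∈ S.R, S.coroot γ x * S.coroot γ y

lemma two_mul_form {α : V} (hα : α ∈ S.R) (x : V) :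
    2 * S.form x α = S.coroot α x * S.form α α := by
  have hinv : ∀ β ∈ S.R,
      (β - S.coroot α β • α) - S.coroot α (β - S.coroot α β • α) • α = β := by
    intro β _
    simp only [map_sub, map_smul, smul_eq_mul, S.coroot_self α hα]
    module
  have h : S.form x α = ∑ γ ∈ S.R,
      (S.coroot γ x - S.coroot γ α * S.coroot α x) * (-S.coroot γ α) := by
    refine Finset.sum_nbij' (fun β => β - S.coroot α β • α) (fun β => β - S.coroot α β • α)
      (S.reflect_root α hα) (S.reflect_root α hα) hinv hinv ?_
    intro γ hγ
    simp only [S.reflect_coroot α hα γ hγ, S.coroot_self α hα]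
    ring
  have h2 : S.form x α = -S.form x α + S.coroot α x * S.form α α := by
    conv_lhs => rw [h]
    simp only [form, Finset.mul_sum, ← Finset.sum_neg_distrib, ← Finset.sum_add_distrib]
    exact Finset.sum_congr rfl fun γ _ => by ring
  linarith

lemma form_comm (x y : V) : S.form x y = S.form y x :=
  Finset.sum_congr rfl fun _ _ => mul_comm _ _

lemma form_self_pos {α : V} (hα : α ∈ S.R) : 0 < S.form α α := by
  refine Finset.sum_pos' (fun γ _ => mul_self_nonneg _) ⟨α, hα, ?_⟩
  rw [S.coroot_self α hα]
  norm_num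

lemma coroot_mul_form {α β : V} (hα : α ∈ S.R) (hβ : β ∈ S.R) :
    S.coroot α β * S.form α α = S.coroot β α * S.form β β := by
  rw [← S.two_mul_form hα, ← S.two_mul_form hβ, S.form_comm]

lemma coroot_pos_symm {α β : V} (hα : α ∈ S.R) (hβ : β ∈ S.R) (h : 0 < S.coroot α β) :
    0 < S.coroot β α := by
  have h1 := mul_pos h (S.form_self_pos hα)
  rw [S.coroot_mul_form hα hβ] at h1
  exact pos_of_mul_pos_left h1 (S.form_self_pos hβ).le

lemma coroot_eq_zero_symm {α β : V} (hα : α ∈ S.R) (hβ : β ∈ S.R) (h : S.coroot α β = 0) :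
    S.coroot β α = 0 := by
  have h1 := S.coroot_mul_form hα hβ
  rw [h, zero_mul] at h1
  exact (mul_eq_zero.1 h1.symm).resolve_right (S.form_self_pos hβ).ne'

/-- Two roots whose difference is killed by all coroots agree. -/
lemma eq_of_coroot_sub_eq_zero {α β : V} (hα : α ∈ S.R) (hβ : β ∈ S.R)
    (h : ∀ γ ∈ S.R, S.coroot γ (α - β) = 0) : α = β := by
  by_contra hne
  have key : ∀ n : ℕ, β + (n : ℝ) • (α - β) ∈ S.R ∧ β + ((n : ℝ) + 1) • (α - β) ∈ S.R := by
    intro n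
    induction n with
    | zero => simpa using ⟨hβ, hα⟩
    | succ n ih =>
      obtain ⟨h1, h2⟩ := ih
      push_cast
      refine ⟨h2, ?_⟩
      have h3 := S.neg_mem _ (S.reflect_root _ h2 _ h1)
      have h4 : S.coroot (β + ((n : ℝ) + 1) • (α - β)) (β + (n : ℝ) • (α - β)) = 2 := by
        have h5 := S.coroot_self _ h2
        have h6 := h _ h2
        rw [map_add, map_smul, h6, smul_zero, add_zero] at h5 ⊢
        exact h5
      rw [h4] at h3
      convert h3 using 1
      module
  refine (Set.infinite_of_injective_forall_mem (s := (S.R : Set V))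
    (f := fun n : ℕ => β + (n : ℝ) • (α - β)) ?_ fun n => (key n).1) S.R.finite_toSet
  intro m n hmn
  have h1 : (m : ℝ) • (α - β) = (n : ℝ) • (α - β) := add_left_cancel hmn
  exact_mod_cast smul_left_injective ℝ (sub_ne_zero.2 hne) h1

lemma eq_of_two_le_coroot {α β : V} (hα : α ∈ S.R) (hβ : β ∈ S.R)
    (h1 : 2 ≤ S.coroot α β) (h2 : 2 ≤ S.coroot β α) : α = β := by
  refine S.eq_of_coroot_sub_eq_zero hα hβ ?_
  have hA := S.form_self_pos hα
  have hB := S.form_self_pos hβ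
  have e1 := S.two_mul_form hα β
  have e2 := S.two_mul_form hβ α
  rw [S.form_comm] at e1
  have hexp : S.form (α - β) (α - β) = S.form α α + S.form β β - 2 * S.form α β := by
    simp only [form, Finset.mul_sum, ← Finset.sum_sub_distrib, ← Finset.sum_add_distrib, map_sub]
    exact Finset.sum_congr rfl fun γ _ => by ring
  have hle : S.form (α - β) (α - β) ≤ 0 := by nlinarith
  have h0 : ∀ γ ∈ S.R, 0 ≤ S.coroot γ (α - β) * S.coroot γ (α - β) :=
    fun γ _ => mul_self_nonneg _
  have hz := (Finset.sum_eq_zero_iff_of_nonneg h0).1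
    (le_antisymm hle (Finset.sum_nonneg h0))
  exact fun γ hγ => mul_self_eq_zero.1 (hz γ hγ)

/-- `x` is strictly dominant. -/
def StrictDom (x : V) : Prop := ∀ γ ∈ S.Rpos, 0 < S.coroot γ x

/-- The coroot `α∨` has maximal pairing with `x` among all coroots. -/
def IsMaxFor (x α : V) : Prop := α ∈ S.R ∧ ∀ γ ∈ S.R, S.coroot γ x ≤ S.coroot α x

variable {S}

lemma IsMaxFor.coroot_nonneg {x α : V} (hx : S.StrictDom x) (h : S.IsMaxFor x α) :
    ∀ δ ∈ S.Rpos, 0 ≤ S.coroot α δ := by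
  intro δ hδ
  by_contra! hneg
  have hδR := S.pos_subset hδ
  have h1 := h.2 _ (S.reflect_root δ hδR α h.1)
  rw [S.reflect_coroot δ hδR α h.1] at h1
  nlinarith [hx δ hδ]

lemma IsMaxFor.isHighestCoroot {x α : V} (hx : S.StrictDom x) (h : S.IsMaxFor x α) :
    S.IsHighestCoroot α := by
  refine ⟨h.1, fun β hβ => h.coroot_nonneg hx β (S.simple_subset hβ), ?_⟩
  intro β hβ γ hγ he
  have h1 := h.2 γ hγ
  rw [he, LinearMap.add_apply] at h1
  linarith [hx β (S.simple_subset hβ)]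

/-- Maximal coroots of two strictly dominant weights do not differ by a coroot. -/
lemma IsMaxFor.coroot_ne_one {x y α β : V} (hx : S.StrictDom x) (hy : S.StrictDom y)
    (hα : S.IsMaxFor x α) (hβ : S.IsMaxFor y β) : S.coroot α β ≠ 1 := by
  intro h1
  have hγ := S.reflect_root β hβ.1 α hα.1
  have hc := S.reflect_coroot β hβ.1 α hα.1
  rcases S.pos_or_neg _ hγ with hp | hn
  · have h2 := hy _ hp
    rw [hc, h1] at h2
    linarith [hβ.2 α hα.1]
  · have h2 := hx _ hn
    rw [S.coroot_neg _ hγ, LinearMap.neg_apply, hc, h1] at h2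
    linarith [hα.2 β hβ.1]

lemma IsMaxFor.orthogonal_of_orthogonal {x y α β δ : V} (hx : S.StrictDom x)
    (hy : S.StrictDom y) (hα : S.IsMaxFor x α) (hβ : S.IsMaxFor y β)
    (h0 : S.coroot β α = 0) (hδ : δ ∈ S.R) (hδβ : S.coroot β δ ≠ 0) :
    S.coroot α δ = 0 := by
  wlog hp : δ ∈ S.Rpos generalizing δ
  · have h1 := this (S.neg_mem δ hδ) (by simpa using hδβ)
      ((S.pos_or_neg δ hδ).resolve_left hp)
    simpa using h1
  by_contra hne
  have h1 : 0 < S.coroot β δ := lt_of_le_of_ne (hβ.coroot_nonneg hy δ hp) hδβ.symm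
  have h2 : 0 < S.coroot α δ := lt_of_le_of_ne (hα.coroot_nonneg hx δ hp) (Ne.symm hne)
  have hγ := S.reflect_root α hα.1 δ hδ
  have hpos : δ - S.coroot α δ • α ∈ S.Rpos := by
    refine (S.pos_or_neg _ hγ).resolve_right fun hn => ?_
    have h3 := hβ.coroot_nonneg hy _ hn
    rw [map_neg, map_sub, map_smul, h0, smul_zero] at h3
    linarith
  have h3 := hx _ hpos
  rw [S.reflect_coroot α hα.1 δ hδ] at h3
  have h4 : 1 ≤ S.coroot δ α := by
    have h5 := S.coroot_pos_symm hα.1 hδ h2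
    obtain ⟨n, hn⟩ := S.crystallographic δ hδ α hα.1
    rw [hn] at h5 ⊢
    exact_mod_cast h5
  nlinarith [hx δ hp, hα.2 δ hδ]

/-- Weyl-conjugate maximal roots for two strictly dominant weights coincide. -/
lemma IsMaxFor.eq_of_conj {x y α : V} {v : V ≃ₗ[ℝ] V} (hv : v ∈ S.Weyl)
    (hx : S.StrictDom x) (hy : S.StrictDom y)
    (hα : S.IsMaxFor x α) (hβ : S.IsMaxFor y (v α)) : v α = α := by
  set β := v α with hβdef
  have hβp : β ∈ S.Rpos := by
    refine (S.pos_or_neg _ hβ.1).resolve_right fun hn => ?_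
    have h1 := hy _ hn
    have h2 := hβ.2 _ (S.pos_subset hn)
    rw [S.coroot_neg _ hβ.1, LinearMap.neg_apply] at h1 h2
    linarith
  rcases (hα.coroot_nonneg hx β hβp).eq_or_lt with h0 | hpos
  · exfalso
    have h0' := S.coroot_eq_zero_symm hα.1 hβ.1 h0.symm
    have hstable : ∀ g ∈ S.Weyl, ∀ γ ∈ S.R,
        (∀ δ ∈ S.R, S.coroot β δ ≠ 0 → S.coroot γ δ = 0) →
        ∀ δ ∈ S.R, S.coroot β δ ≠ 0 → S.coroot (g γ) δ = 0 := by
      have key : ∀ g : V ≃ₗ[ℝ] V, (∃ α ∈ S.R, ∀ x, g x = x - S.coroot α x • α) →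
          ∀ γ ∈ S.R, (∀ δ ∈ S.R, S.coroot β δ ≠ 0 → S.coroot γ δ = 0) →
          ∀ δ ∈ S.R, S.coroot β δ ≠ 0 → S.coroot (g γ) δ = 0 := by
        rintro g ⟨ε, hε, hg⟩ γ hγ hort δ hδ hδβ
        rw [hg, S.reflect_coroot ε hε γ hγ, hort δ hδ hδβ]
        by_cases hεβ : S.coroot β ε = 0
        · have h3 := hort _ (S.reflect_root ε hε δ hδ) (by
            rwa [map_sub, map_smul, hεβ, smul_zero, sub_zero])
          rw [map_sub, map_smul, smul_eq_mul, hort δ hδ hδβ] at h3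
          linarith
        · rw [hort ε hε hεβ]
          ring
      intro g hg
      induction hg using Subgroup.closure_induction'' with
      | mem g hg => exact key g hg
      | inv_mem g hg =>
        obtain ⟨ε, hε, hg⟩ := hg
        refine key _ ⟨ε, hε, fun z => ?_⟩
        change g.symm z = _
        rw [LinearEquiv.symm_apply_eq, hg]
        simp only [map_sub, map_smul, smul_eq_mul, S.coroot_self ε hε]
        module
      | one => exact fun γ _ h => h
      | mul a b _ hb' ha hb =>
        exact fun γ hγ h => ha _ (S.Weyl_root_and_coroot hb' γ hγ).1 (hb γ hγ h)
    have hself := S.coroot_self β hβ.1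
    have h3 := hstable v hv α hα.1
      (fun δ hδ hδβ => hα.orthogonal_of_orthogonal hx hy hβ h0' hδ hδβ) β hβ.1
      (by rw [hself]; norm_num)
    rw [← hβdef, hself] at h3
    norm_num at h3
  · have two_le : ∀ {γ δ : V}, γ ∈ S.R → δ ∈ S.R → 0 < S.coroot γ δ →
        S.coroot γ δ ≠ 1 → 2 ≤ S.coroot γ δ := by
      intro γ δ hγ hδ h1 h2
      obtain ⟨n, hn⟩ := S.crystallographic γ hγ δ hδ
      rw [hn] at h1 h2 ⊢
      have h3 : 0 < n := by exact_mod_cast h1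
      have h4 : n ≠ 1 := by exact_mod_cast h2
      exact_mod_cast (by omega : 2 ≤ n)
    exact (S.eq_of_two_le_coroot hα.1 hβ.1
      (two_le hα.1 hβ.1 hpos (hα.coroot_ne_one hx hy hβ))
      (two_le hβ.1 hα.1 (S.coroot_pos_symm hα.1 hβ.1 hpos)
        (hβ.coroot_ne_one hy hx hα))).symm

lemma strictDom_of_sub_eta_mem_C0 {p : ℕ} {x : V} (h : x - S.eta ∈ S.C0 p) :
    S.StrictDom x := fun γ hγ => by
  simpa using (h γ hγ).1

lemma coroot_le_of_sub_eta_mem_C0 {p : ℕ} (hp : 0 < p) {x : V} (hxX : x ∈ S.X)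
    (h : x - S.eta ∈ S.C0 p) : ∀ γ ∈ S.R, S.coroot γ x ≤ (p : ℝ) - 1 := by
  intro γ hγ
  have hp1 : (1 : ℝ) ≤ p := by exact_mod_cast hp
  rcases S.pos_or_neg γ hγ with hpos | hneg
  · have h1 := (h γ hpos).2
    rw [sub_add_cancel] at h1
    obtain ⟨n, hn⟩ := S.coroot_int γ hγ x hxX
    rw [hn] at h1 ⊢
    have h2 : n < (p : ℤ) := by exact_mod_cast h1
    have h3 : n ≤ (p : ℤ) - 1 := by omega
    exact_mod_cast h3
  · have h1 := strictDom_of_sub_eta_mem_C0 h _ hneg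
    rw [S.coroot_neg γ hγ, LinearMap.neg_apply] at h1
    linarith

lemma exists_odd_coroot {x : V} (hxX : x ∈ S.X) (h : x - S.eta ∈ S.C0 2) :
    ∀ γ ∈ S.R, ∃ n : ℤ, Odd n ∧ S.coroot γ x = n := by
  have key : ∀ γ ∈ S.Rpos, S.coroot γ x = 1 := by
    intro γ hγ
    have h1 := (h γ hγ).2
    rw [sub_add_cancel] at h1
    have h2 := strictDom_of_sub_eta_mem_C0 h γ hγ
    obtain ⟨n, hn⟩ := S.coroot_int γ (S.pos_subset hγ) x hxX
    rw [hn] at h1 h2 ⊢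
    have h3 : 0 < n := by exact_mod_cast h2
    have h4 : n < 2 := by exact_mod_cast h1
    exact_mod_cast (by omega : n = 1)
  intro γ hγ
  rcases S.pos_or_neg γ hγ with hpos | hneg
  · exact ⟨1, odd_one, by rw [key γ hpos, Int.cast_one]⟩
  · have h1 := key _ hneg
    rw [S.coroot_neg γ hγ, LinearMap.neg_apply] at h1
    exact ⟨-1, odd_neg_one, by push_cast; linarith⟩

end Ctx

/-- Claim `ht2`: `⟨ν,α∨⟩ ≤ 2` for every root `α`, with equality if and
only if `α∨` is a highest coroot, `⟨μ,α∨⟩ = p−1 = ⟨λ,α∨⟩`, `u` commutes with `s_α`, and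
`⟨w(π(ν)),α∨⟩ = 2`. -/
theorem statement10 {V : Type} [AddCommGroup V] [Module ℝ V] [FiniteDimensional ℝ V]
    (S : Ctx V) (p : ℕ) (hp : p.Prime) (hηp : ∀ α ∈ S.R, S.coroot α S.eta < (p : ℝ))
    (π : V ≃ₗ[ℝ] V)
    (hπR : ∀ α ∈ S.R, π α ∈ S.R) (hπpos : ∀ α ∈ S.Rpos, π α ∈ S.Rpos)
    (hπΔ : ∀ α ∈ S.Δ, π α ∈ S.Δ) (hπX : ∀ x ∈ S.X, π x ∈ S.X)
    (hπpair : ∀ α ∈ S.R, ∀ x : V, S.coroot (π α) (π x) = S.coroot α x)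
    (hπη : π S.eta = S.eta)
    (hπord : ∃ m : ℕ, 0 < m ∧ π ^ m = 1)
    (μ lam : V) (hμX : μ ∈ S.X) (hlamX : lam ∈ S.X)
    (hμC : μ - S.eta ∈ S.C0 p) (hlamC : lam - S.eta ∈ S.C0 p)
    (s w u : V ≃ₗ[ℝ] V) (hs : s ∈ S.Weyl) (hw : w ∈ S.Weyl) (hu : u ∈ S.Weyl)
    (ν : V) (hν : ν ∈ S.X)
    (hconj : w = u * s * π * u⁻¹ * π⁻¹)
    (hlam : lam = u μ + (p : ℝ) • ν - w (π ν)) :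
    (∀ α ∈ S.R, S.coroot α ν ≤ 2) ∧
      ∀ α ∈ S.R,
        (S.coroot α ν = 2 ↔
          S.IsHighestCoroot α ∧ S.coroot α μ = (p : ℝ) - 1 ∧
          S.coroot α lam = (p : ℝ) - 1 ∧
          (∀ x : V, u (x - S.coroot α x • α) = u x - S.coroot α (u x) • α) ∧
          S.coroot α (w (π ν)) = 2) := by
  have hp2 : (2 : ℝ) ≤ p := by exact_mod_cast hp.two_le
  have hμd := Ctx.strictDom_of_sub_eta_mem_C0 hμC
  have hld := Ctx.strictDom_of_sub_eta_mem_C0 hlamC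
  have hμle := Ctx.coroot_le_of_sub_eta_mem_C0 hp.pos hμX hμC
  have hlle := Ctx.coroot_le_of_sub_eta_mem_C0 hp.pos hlamX hlamC
  have hcomp : ∀ α ∈ S.R, ∃ γ ∈ S.R, ∀ x, S.coroot α (w (π x)) = S.coroot γ x := by
    intro α hα
    obtain ⟨h1, h2⟩ := S.exists_coroot_comp_Weyl hw hα
    obtain ⟨γ, hγ, hγe⟩ := Finset.surj_on_of_inj_on_of_card_le (s := S.R) (t := S.R)
      (fun a _ => π a) hπR (fun a b _ _ hab => π.injective hab) le_rfl _ h1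
    refine ⟨γ, hγ, fun x => ?_⟩
    rw [h2, hγe, hπpair γ hγ]
  have heq : ∀ α, S.coroot α lam =
      S.coroot α (u μ) + p * S.coroot α ν - S.coroot α (w (π ν)) := by
    intro α
    conv_lhs => rw [hlam]
    simp only [map_sub, map_add, map_smul, smul_eq_mul]
  have hule : ∀ α ∈ S.R, -((p : ℝ) - 1) ≤ S.coroot α (u μ) := by
    intro α hα
    obtain ⟨h1, h2⟩ := S.exists_coroot_comp_Weyl hu hα
    have h3 := hμle _ (S.neg_mem _ h1)
    rw [S.coroot_neg _ h1, LinearMap.neg_apply] at h3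
    rw [h2]
    linarith
  have hbound : ∀ α ∈ S.R, S.coroot α ν ≤ 2 := by
    intro α hα
    obtain ⟨β, hβ, hmax⟩ := Finset.exists_max_image S.R (fun α => S.coroot α ν) ⟨α, hα⟩
    refine (hmax α hα).trans ?_
    obtain ⟨γ, hγ, hγe⟩ := hcomp β hβ
    have h1 := heq β
    rw [hγe] at h1
    nlinarith [hmax γ hγ, hlle β hβ, hule β hβ]
  refine ⟨hbound, fun α hα => ⟨fun h2 => ?_, ?_⟩⟩
  · obtain ⟨γ, hγ, hγe⟩ := hcomp α hα
    have h1 := heq α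
    have hb := hbound γ hγ
    rw [← hγe ν] at hb
    rw [h2] at h1
    have hl := hlle α hα
    have hm := hule α hα
    have el : S.coroot α lam = (p : ℝ) - 1 := by linarith
    have em : S.coroot α (u μ) = -((p : ℝ) - 1) := by linarith
    have hαmax : S.IsMaxFor lam α := ⟨hα, fun γ hγ => by rw [el]; exact hlle γ hγ⟩
    obtain ⟨hi, hie⟩ := S.exists_coroot_comp_Weyl hu hα
    rw [hie] at em
    obtain ⟨r, hr, hre⟩ : ∃ r ∈ S.Weyl, ∀ x, r x = x - S.coroot α x • α :=
      ⟨Module.reflection (S.coroot_self α hα),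
        Subgroup.subset_closure ⟨α, hα, fun x => Module.reflection_apply _ _⟩,
        fun x => Module.reflection_apply _ _⟩
    have hconjα : (u⁻¹ * r) α = -(u⁻¹ α) := by
      change u⁻¹ (r α) = _
      rw [hre, S.coroot_self α hα, ← map_neg]
      congr 1
      module
    have hfix : (u⁻¹ * r) α = α := by
      refine hαmax.eq_of_conj (mul_mem (inv_mem hu) hr) hld hμd ?_
      rw [hconjα]
      refine ⟨S.neg_mem _ hi, fun γ hγ => ?_⟩
      rw [S.coroot_neg _ hi, LinearMap.neg_apply, em, neg_neg]
      exact hμle γ hγ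
    have hinv : u⁻¹ α = -α := neg_eq_iff_eq_neg.1 (hconjα.symm.trans hfix)
    have huα : u α = -α := by
      have h3 : u (u.symm α) = u (-α) := congrArg u hinv
      rw [LinearEquiv.apply_symm_apply, map_neg] at h3
      exact neg_eq_iff_eq_neg.1 h3.symm
    have hcu : ∀ x, S.coroot α (u x) = -S.coroot α x := by
      intro x
      rw [hie, hinv, S.coroot_neg α hα, LinearMap.neg_apply]
    refine ⟨hαmax.isHighestCoroot hld, ?_, el, fun x => ?_, by linarith⟩
    · rw [← hie, hcu] at em
      linarith
    · rw [hcu, map_sub, map_smul, huα]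
      module
  · rintro ⟨-, hμα, hlα, hcomm, hwα⟩
    have h1 := heq α
    rw [hlα, hwα] at h1
    have h3 := hcomm α
    rw [S.coroot_self α hα, map_sub, map_smul] at h3
    have h4 : u α = (S.coroot α (u α) / 2) • α := by
      have h5 : (2 : ℝ) • u α = S.coroot α (u α) • α := sub_right_injective h3
      rw [div_eq_inv_mul, mul_smul, ← h5, smul_smul]
      norm_num
    obtain ⟨huR, hue⟩ := S.Weyl_root_and_coroot hu α hα
    have h5 := hue μ
    rcases S.reduced α hα _ (h4 ▸ huR) with hc | hc
    · exfalso
      rw [hc, one_smul] at h4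
      rw [h4, hμα] at h5
      rw [h5] at h1
      obtain ⟨n, hn⟩ := S.coroot_int α hα ν hν
      rw [hn] at h1
      have h6 : (p : ℤ) * n = 2 := by
        have : (p : ℝ) * n = 2 := by linarith
        exact_mod_cast this
      have h7 : p = 2 := by
        have h8 : (p : ℤ) ∣ 2 := ⟨n, h6.symm⟩
        have h9 : p ∣ 2 := by exact_mod_cast h8
        exact (Nat.prime_dvd_prime_iff_eq hp Nat.prime_two).1 h9
      subst h7
      have hn1 : n = 1 := by
        push_cast at h6
        omega
      have hβ := (S.Weyl_root_and_coroot hw _ (hπR α hα)).1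
      have hβe := (S.Weyl_root_and_coroot hw _ (hπR α hα)).2 (π ν)
      rw [hπpair α hα, hn, hn1] at hβe
      have h8 := heq (w (π α))
      rw [hβe] at h8
      obtain ⟨m, hm⟩ := S.coroot_int _ hβ ν hν
      obtain ⟨hi, hie⟩ := S.exists_coroot_comp_Weyl hu hβ
      obtain ⟨a, ha, hae⟩ := Ctx.exists_odd_coroot hlamX hlamC _ hβ
      obtain ⟨b, hb, hbe⟩ := Ctx.exists_odd_coroot hμX hμC _ hi
      rw [hie, hm, hae, hbe] at h8
      have h9 : a = b + 2 * m - 1 := by exact_mod_cast h8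
      obtain ⟨c, rfl⟩ := ha
      obtain ⟨d, rfl⟩ := hb
      omega
    · rw [hc, neg_one_smul] at h4
      rw [h4, S.coroot_neg α hα, LinearMap.neg_apply, hμα] at h5
      have h6 : (p : ℝ) * (S.coroot α ν - 2) = 0 := by linarith
      rcases mul_eq_zero.1 h6 with h7 | h7
      · linarith
      · linarith

end SerrePaper
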